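/- arXiv:2007.15997 — 2 statements merged into one kernel-verified Lean document; each statement's English description precedes it below -/
import Mathlib

section
/- Let L be a number field of degree g over ℚ, let M be a number field which is Galois over ℚ and contains an isomorphic copy of L, let 𝔊 denote the set of ℚ-algebra embeddings σ : L → M (so 𝔊 has exactly g elements), and let d_L ∈ ℤ be the discriminant of L. Let R be a commutative algebra over the ring of integers O_M of M in which d_L is invertible. Then every module N over the ring O_L ⊗_ℤ R decomposes canonically as the internal direct sum N = ⊕_{σ ∈ 𝔊} N(σ) of the R-submodules N(σ) = { n ∈ N : (x ⊗ 1)·n = (1 ⊗ σ(x)·1_R)·n for all x ∈ O_L }. -/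
open scoped TensorProduct

open NumberField

/-- For an embedding `σ : L → M`, the `σ`-eigencomponent
`N(σ) = { n ∈ N : (x ⊗ 1) • n = (1 ⊗ σ(x)·1_R) • n for all x ∈ O_L }`
of a module `N` over `O_L ⊗_ℤ R`.  It is in particular stable under the
action of `R` (via `r ↦ 1 ⊗ r`), i.e. an `R`-submodule of `N`. -/
def eigenComponent
    (L M : Type) [Field L] [NumberField L] [Field M] [NumberField M]
    (R : Type) [CommRing R] [Algebra (𝓞 M) R]
    (N : Type) [AddCommGroup N] [Module ((𝓞 L) ⊗[ℤ] R) N]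
    (σ : L →ₐ[ℚ] M) : Submodule ((𝓞 L) ⊗[ℤ] R) N where
  carrier := { n : N | ∀ x : 𝓞 L,
    ((x ⊗ₜ[ℤ] (1 : R)) : (𝓞 L) ⊗[ℤ] R) • n =
      (((1 : 𝓞 L) ⊗ₜ[ℤ] (algebraMap (𝓞 M) R (RingOfIntegers.mapRingHom σ x) * 1)) :
        (𝓞 L) ⊗[ℤ] R) • n }
  add_mem' := by
    intro a b ha hb x
    rw [smul_add, smul_add, ha x, hb x]
  zero_mem' := by
    intro x
    rw [smul_zero, smul_zero]
  smul_mem' := by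
    intro c n hn x
    rw [← mul_smul, mul_comm, mul_smul, hn x, ← mul_smul, mul_comm, mul_smul]

/-- If `b` is a `ℤ`-basis of `A` and the matrix `(f σ (b i))` attached to a family of ring
homomorphisms `f σ : A →+* R` is invertible, then `A ⊗[ℤ] R` has a family of elements dual to `f`
which decomposes every pure tensor `x ⊗ₜ 1`. -/
theorem exists_dual_family_of_isUnit_det {A R κ : Type*} [CommRing A] [CommRing R] [Fintype κ]
    [DecidableEq κ] (b : Module.Basis κ ℤ A) (f : κ → A →+* R)
    (h : IsUnit (Matrix.of fun i σ => f σ (b i)).det) :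
    ∃ ε : κ → A ⊗[ℤ] R,
      (∀ x : A, x ⊗ₜ[ℤ] (1 : R) = ∑ σ, ((1 : A) ⊗ₜ[ℤ] f σ x) * ε σ) ∧
      ∀ σ τ, Algebra.TensorProduct.lift (f τ).toIntAlgHom (AlgHom.id ℤ R)
        (fun _ _ => Commute.all _ _) (ε σ) = if σ = τ then 1 else 0 := by
  set S : Matrix κ κ R := Matrix.of fun i σ => f σ (b i) with hS
  refine ⟨fun σ => ∑ j, b j ⊗ₜ[ℤ] S⁻¹ σ j, fun x => ?_, fun σ τ => ?_⟩
  · let F : A →+ A ⊗[ℤ] R :=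
      (Algebra.TensorProduct.includeLeft : A →ₐ[ℤ] A ⊗[ℤ] R).toRingHom.toAddMonoidHom
    let G : A →+ A ⊗[ℤ] R := ∑ σ, (AddMonoidHom.mulRight (∑ j, b j ⊗ₜ[ℤ] S⁻¹ σ j)).comp
      ((Algebra.TensorProduct.includeRight : R →ₐ[ℤ] A ⊗[ℤ] R).toRingHom.comp
        (f σ)).toAddMonoidHom
    have hFG : F.toIntLinearMap = G.toIntLinearMap := by
      refine b.ext fun i => ?_
      have hone : ∀ j, ∑ σ, S i σ * S⁻¹ σ j = (1 : Matrix κ κ R) i j := fun j => by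
        rw [← Matrix.mul_nonsing_inv S h, Matrix.mul_apply]
      have : ∑ σ, ((1 : A) ⊗ₜ[ℤ] S i σ) * ∑ j, b j ⊗ₜ[ℤ] S⁻¹ σ j = b i ⊗ₜ[ℤ] (1 : R) := by
        simp_rw [Finset.mul_sum, Algebra.TensorProduct.tmul_mul_tmul, one_mul]
        rw [Finset.sum_comm]
        simp_rw [← TensorProduct.tmul_sum, hone, Matrix.one_apply]
        rw [Finset.sum_eq_single i (fun j _ hj => by simp [hj.symm]) (by simp)]
        simp
      simpa [F, G, AddMonoidHom.finsetSum_apply, hS] using this.symm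
    simpa [F, G, AddMonoidHom.finsetSum_apply] using LinearMap.congr_fun hFG x
  · have : ∑ j, S⁻¹ σ j * S j τ = (1 : Matrix κ κ R) σ τ := by
      rw [← Matrix.nonsing_inv_mul S h, Matrix.mul_apply]
    rw [Matrix.one_apply] at this
    rw [← this, map_sum]
    refine Finset.sum_congr rfl fun j _ => ?_
    simp [hS, mul_comm]

/-- Composition with a field extension `M → E` is bijective on embeddings of `L` when `M` is normal
and contains a copy of `L`. -/
theorem AlgHom.comp_bijective_of_normal {F L M E : Type*} [Field F] [Field L] [Field M] [Field E]
    [Algebra F L] [Algebra F M] [Algebra F E] [Normal F M] (i : L →ₐ[F] M) (j : M →ₐ[F] E) :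
    Function.Bijective fun σ : L →ₐ[F] M => j.comp σ := by
  refine ⟨fun σ τ h => AlgHom.ext fun x => j.injective (DFunLike.congr_fun h x), fun ψ => ?_⟩
  have hsplit : ∀ x : L, ((minpoly F x).map (algebraMap F M)).Splits := fun x => by
    rw [← minpoly.algHom_eq i i.injective x]
    exact Normal.splits inferInstance (i x)
  have hmem : ∀ x : L, ψ x ∈ j.range := fun x => by
    have hx : IsIntegral F x :=
      (isIntegral_algHom_iff i i.injective).mp (Normal.isIntegral inferInstance (i x))
    have hroot : ψ x ∈ ((minpoly F x).map (algebraMap F E)).roots := by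
      rw [Polynomial.mem_roots
        ((Polynomial.map_ne_zero_iff (algebraMap F E).injective).mpr (minpoly.ne_zero hx)),
        Polynomial.IsRoot, Polynomial.eval_map_algebraMap, Polynomial.aeval_algHom_apply,
        minpoly.aeval, map_zero]
    rw [← j.comp_algebraMap, ← Polynomial.map_map, (hsplit x).roots_map] at hroot
    obtain ⟨y, -, hy⟩ := Multiset.mem_map.mp hroot
    exact ⟨y, hy⟩
  refine ⟨(AlgEquiv.ofInjective j j.injective).symm.toAlgHom.comp (ψ.codRestrict _ hmem), ?_⟩
  ext x
  exact congrArg Subtype.val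
    ((AlgEquiv.ofInjective j j.injective).apply_symm_apply ⟨ψ x, hmem x⟩)

/-- The discriminant of `L` is the square of the determinant of the values on an integral basis of
the embeddings of `L` into a Galois extension of `ℚ` containing a copy of `L`. -/
theorem NumberField.discr_eq_det_mapRingHom_sq {L M : Type*} [Field L] [NumberField L] [Field M]
    [NumberField M] [IsGalois ℚ M] (i : L →ₐ[ℚ] M) [DecidableEq (L →ₐ[ℚ] M)]
    (b : Module.Basis (L →ₐ[ℚ] M) ℤ (𝓞 L)) :
    ((discr L : ℤ) : 𝓞 M) =
      (Matrix.of fun (k : L →ₐ[ℚ] M) (σ : L →ₐ[ℚ] M) =>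
        RingOfIntegers.mapRingHom σ (b k)).det ^ 2 := by
  let j : M →ₐ[ℚ] AlgebraicClosure M := IsScalarTower.toAlgHom ℚ M (AlgebraicClosure M)
  let e := Equiv.ofBijective _ (AlgHom.comp_bijective_of_normal i j)
  let φ : 𝓞 M →+* AlgebraicClosure M := j.toRingHom.comp (algebraMap (𝓞 M) M)
  have hφ : Function.Injective φ := j.injective.comp RingOfIntegers.coe_injective
  apply hφ
  have h := Algebra.discr_eq_det_embeddingsMatrixReindex_pow_two ℚ (AlgebraicClosure M)
    (b.localizationLocalization ℚ (nonZeroDivisors ℤ) L) e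
  rw [Algebra.discr_localizationLocalization ℤ (nonZeroDivisors ℤ) L b, discr_eq_discr] at h
  rw [map_pow, RingHom.map_det, map_intCast]
  simp only [eq_intCast, map_intCast] at h
  rw [h]
  congr 2
  ext k σ
  simp [Algebra.embeddingsMatrixReindex, Algebra.embeddingsMatrix, e, φ,
    RingOfIntegers.mapRingHom_apply]

/-- Let `L` be a number field of degree `g` over `ℚ`, `M` a
number field Galois over `ℚ` containing an isomorphic copy of `L`, and `𝔊`
the set of `ℚ`-algebra embeddings `σ : L → M`.  Let `d_L` be the
discriminant of `L` and `R` a commutative `O_M`-algebra in which `d_L` is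
invertible.  Then every module `N` over `O_L ⊗_ℤ R` decomposes canonically
as the internal direct sum `N = ⊕_{σ ∈ 𝔊} N(σ)` of the submodules
`N(σ) = { n ∈ N : (x ⊗ 1) • n = (1 ⊗ σ(x)·1_R) • n for all x ∈ O_L }`. -/
theorem module_over_ringOfIntegersTensor_isInternal_eigenComponents
    (L M : Type) [Field L] [NumberField L] [Field M] [NumberField M]
    [IsGalois ℚ M] (hLM : Nonempty (L →ₐ[ℚ] M))
    (g : ℕ) (hg : Module.finrank ℚ L = g)
    (R : Type) [CommRing R] [Algebra (𝓞 M) R]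
    (hd : IsUnit ((NumberField.discr L : ℤ) : R))
    (N : Type) [AddCommGroup N] [Module ((𝓞 L) ⊗[ℤ] R) N]
    [DecidableEq (L →ₐ[ℚ] M)] :
    DirectSum.IsInternal (fun σ : L →ₐ[ℚ] M => eigenComponent L M R N σ) := by
  obtain ⟨i⟩ := hLM
  let b₀ := RingOfIntegers.basis L
  have hcard : Fintype.card (Module.Free.ChooseBasisIndex ℤ (𝓞 L)) =
      Fintype.card (L →ₐ[ℚ] M) := by
    rw [AlgHom.card_of_splits ℚ L M fun x => ?_, ← RingOfIntegers.rank L,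
      Module.finrank_eq_card_chooseBasisIndex]
    rw [← minpoly.algHom_eq i i.injective x]
    exact Normal.splits inferInstance (i x)
  let b := b₀.reindex (Fintype.equivOfCardEq hcard)
  let f (σ : L →ₐ[ℚ] M) : 𝓞 L →+* R := (algebraMap (𝓞 M) R).comp (RingOfIntegers.mapRingHom σ)
  have hdet : IsUnit (Matrix.of fun k σ => f σ (b k)).det := by
    have h := congrArg (algebraMap (𝓞 M) R) (discr_eq_det_mapRingHom_sq i b)
    rw [map_intCast, map_pow, RingHom.map_det] at h
    rw [h] at hd
    exact (isUnit_pow_iff two_ne_zero).mp hd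
  obtain ⟨ε, hε, hδ⟩ := exists_dual_family_of_isUnit_det b f hdet
  let φ (τ : L →ₐ[ℚ] M) : (𝓞 L) ⊗[ℤ] R →ₐ[ℤ] R :=
    Algebra.TensorProduct.lift (f τ).toIntAlgHom (AlgHom.id ℤ R) (fun _ _ => Commute.all _ _)
  have hdecomp (a : (𝓞 L) ⊗[ℤ] R) : a = ∑ σ, ((1 : 𝓞 L) ⊗ₜ[ℤ] φ σ a) * ε σ := by
    induction a with
    | zero => simp
    | add a a' ha ha' =>
      conv_lhs => rw [ha, ha']
      simp [TensorProduct.tmul_add, add_mul, Finset.sum_add_distrib]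
    | tmul x r =>
      have hx : x ⊗ₜ[ℤ] r = ((1 : 𝓞 L) ⊗ₜ[ℤ] r) * (x ⊗ₜ[ℤ] (1 : R)) := by simp
      conv_lhs => rw [hx, hε x, Finset.mul_sum]
      refine Finset.sum_congr rfl fun σ _ => ?_
      rw [← mul_assoc]
      simp [φ, mul_comm]
  have hinj {a a' : (𝓞 L) ⊗[ℤ] R} (h : ∀ σ, φ σ a = φ σ a') : a = a' := by
    rw [hdecomp a, hdecomp a']
    simp_rw [h]
  have hmem (σ : L →ₐ[ℚ] M) (n : N) : ε σ • n ∈ eigenComponent L M R N σ := fun x => by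
    rw [← mul_smul, ← mul_smul]
    congr 1
    refine hinj fun τ => ?_
    rw [map_mul, map_mul, show φ τ (ε σ) = _ from hδ σ τ]
    split_ifs with h
    · subst h
      simp [φ, f]
    · simp
  have hsum : ∑ σ, ε σ = 1 := by
    simpa [← Algebra.TensorProduct.one_def] using (hε 1).symm
  have hact (τ : L →ₐ[ℚ] M) {n : N} (hn : n ∈ eigenComponent L M R N τ)
      (a : (𝓞 L) ⊗[ℤ] R) : a • n = ((1 : 𝓞 L) ⊗ₜ[ℤ] φ τ a) • n := by
    induction a with
    | zero => simp
    | add a a' ha ha' => rw [add_smul, ha, ha', map_add, TensorProduct.tmul_add, add_smul]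
    | tmul x r =>
      have hx : x ⊗ₜ[ℤ] r = ((1 : 𝓞 L) ⊗ₜ[ℤ] r) * (x ⊗ₜ[ℤ] (1 : R)) := by simp
      rw [hx, mul_smul, hn x, ← mul_smul]
      simp [φ, f, mul_comm]
  have hproj (σ τ : L →ₐ[ℚ] M) {n : N} (hn : n ∈ eigenComponent L M R N τ) :
      ε σ • n = if σ = τ then n else 0 := by
    rw [hact τ hn, show φ τ (ε σ) = _ from hδ σ τ]
    split_ifs
    · rw [← Algebra.TensorProduct.one_def, one_smul]
    · rw [TensorProduct.tmul_zero]
      exact zero_smul ((𝓞 L) ⊗[ℤ] R) n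
  rw [DirectSum.isInternal_submodule_iff_iSupIndep_and_iSup_eq_top]
  constructor
  · rw [iSupIndep_iff_finsetSum_eq_zero_imp_eq_zero]
    intro s v hv hv0 τ hτ
    have h := congrArg (ε τ • ·) hv0
    simp only [Finset.smul_sum, smul_zero] at h
    rw [Finset.sum_congr rfl fun σ hσ => hproj τ σ (hv σ hσ), Finset.sum_ite_eq, if_pos hτ] at h
    exact h
  · refine eq_top_iff.mpr fun n _ => ?_
    rw [← one_smul ((𝓞 L) ⊗[ℤ] R) n, ← hsum, Finset.sum_smul]
    exact Submodule.sum_mem _ fun σ _ => Submodule.mem_iSup_of_mem σ (hmem σ n)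
end

section
/- Let F be a finite Galois extension of ℚ_p with Galois group G = Gal(F/ℚ_p), and let O_F be the ring of integers of F (the integral closure of ℤ_p in F). Assume F/ℚ_p is unramified, i.e. p generates the maximal ideal of O_F. Then for every commutative O_F-algebra R, the ring homomorphism O_F ⊗_{ℤ_p} R → ∏_{σ ∈ G} R determined by x ⊗ r ↦ (σ(x)·r)_{σ ∈ G} (where σ(x) ∈ O_F acts on R through the O_F-algebra structure) is an isomorphism of rings. -/
open scoped TensorProduct

set_option synthInstance.maxHeartbeats 1000000
set_option maxHeartbeats 1000000

/-- The restriction of an element `σ` of the Galois group `Gal(F/ℚ_p)` to a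
ring (indeed `ℤ_p`-algebra) endomorphism of `O_F`, the integral closure of
`ℤ_p` in `F`. -/
noncomputable def galoisRestrictToIntegralClosure
    (p : ℕ) [Fact p.Prime]
    (F : Type) [Field F] [Algebra ℚ_[p] F] [Algebra ℤ_[p] F]
    [IsScalarTower ℤ_[p] ℚ_[p] F]
    (σ : F ≃ₐ[ℚ_[p]] F) :
    integralClosure ℤ_[p] F →ₐ[ℤ_[p]] integralClosure ℤ_[p] F :=
  ((σ.toAlgHom.restrictScalars ℤ_[p]).comp
    (integralClosure ℤ_[p] F).val).codRestrict (integralClosure ℤ_[p] F)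
      (fun x => IsIntegral.map (σ.toAlgHom.restrictScalars ℤ_[p]) x.2)

/-- The natural ring homomorphism `O_F ⊗_{ℤ_p} R → ∏_{σ ∈ Gal(F/ℚ_p)} R`
sending `x ⊗ r` to `(σ(x) · r)_σ`, where `σ(x) ∈ O_F` acts on `R` through
the `O_F`-algebra structure of `R`. -/
noncomputable def integralClosureTensorToPi
    (p : ℕ) [Fact p.Prime]
    (F : Type) [Field F] [Algebra ℚ_[p] F] [Algebra ℤ_[p] F]
    [IsScalarTower ℤ_[p] ℚ_[p] F]
    (R : Type) [CommRing R] [Algebra (integralClosure ℤ_[p] F) R]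
    [Algebra ℤ_[p] R] [IsScalarTower ℤ_[p] (integralClosure ℤ_[p] F) R] :
    (integralClosure ℤ_[p] F) ⊗[ℤ_[p]] R →+* ((F ≃ₐ[ℚ_[p]] F) → R) :=
  Pi.ringHom fun σ =>
    (Algebra.TensorProduct.lift
      ((IsScalarTower.toAlgHom ℤ_[p] (integralClosure ℤ_[p] F) R).comp
        (galoisRestrictToIntegralClosure p F σ))
      (AlgHom.id ℤ_[p] R) (fun _ _ => Commute.all _ _)).toRingHom

/-- If Frobenius is surjective on `B / pB`, then a ring endomorphism of `B` inducing the identity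
modulo `p` induces the identity modulo every power of `p`. -/
theorem natCast_pow_dvd_map_sub_self {B : Type*} [CommRing B] {p : ℕ} (hp : p.Prime)
    (hfrob : ∀ x : B, ∃ y, (p : B) ∣ x - y ^ p) (s : B →+* B)
    (hs : ∀ x, (p : B) ∣ s x - x) (k : ℕ) (x : B) : (p : B) ^ k ∣ s x - x := by
  induction k generalizing x with
  | zero => simp
  | succ k ih =>
    rcases k.eq_zero_or_pos with rfl | hk
    · simpa using hs x
    obtain ⟨y, z, hz⟩ := hfrob x
    obtain ⟨d, hd⟩ := ih y
    obtain ⟨e, he⟩ := ih z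
    obtain ⟨r, hr⟩ := exists_add_pow_prime_eq hp y ((p : B) ^ k * d)
    have hx : x = y ^ p + p * z := by linear_combination hz
    have hsy : s y = y + (p : B) ^ k * d := by linear_combination hd
    have hpow : (p : B) ^ (k + 1) ∣ ((p : B) ^ k * d) ^ p := by
      rw [mul_pow, ← pow_mul]
      exact (pow_dvd_pow _ (by nlinarith [hp.two_le])).mul_right _
    obtain ⟨c, hc⟩ := hpow
    refine ⟨c + y * d * r + e, ?_⟩
    rw [hx, map_add, map_mul, map_pow, map_natCast, hsy, hr, hc]
    linear_combination (p : B) * he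

/-- Frobenius is surjective on the quotient of a finite `ℤ_p`-algebra by `p`, if this quotient
is a field. -/
theorem exists_natCast_dvd_sub_pow (p : ℕ) [Fact p.Prime] {B : Type*} [CommRing B]
    [Algebra ℤ_[p] B] [Module.Finite ℤ_[p] B] (hmax : (Ideal.span {(p : B)}).IsMaximal) (x : B) :
    ∃ y, (p : B) ∣ x - y ^ p := by
  have : Finite (ℤ_[p] ⧸ Ideal.span {(p : ℤ_[p])}) := by
    rw [← PadicInt.maximalIdeal_eq_span_p]
    infer_instance
  have hfin := Submodule.finite_quotient_smul (Ideal.span {(p : ℤ_[p])})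
    (Module.Finite.fg_top : (⊤ : Submodule ℤ_[p] B).FG)
  rw [Ideal.smul_top_eq_map, Ideal.map_span, Set.image_singleton, map_natCast] at hfin
  have : Finite (B ⧸ Ideal.span {(p : B)}) :=
    Finite.of_equiv _ (Submodule.Quotient.restrictScalarsEquiv ℤ_[p] _).toEquiv
  have hchar : CharP (B ⧸ Ideal.span {(p : B)}) p := by
    refine (CharP.charP_iff_prime_eq_zero Fact.out).2 ?_
    simpa using Ideal.Quotient.eq_zero_iff_mem.2 (Ideal.mem_span_singleton_self (p : B))
  have : ExpChar (B ⧸ Ideal.span {(p : B)}) p := .prime Fact.out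
  have := PerfectRing.ofFiniteOfIsReduced p (B ⧸ Ideal.span {(p : B)})
  obtain ⟨ybar, hy⟩ := surjective_frobenius (B ⧸ Ideal.span {(p : B)}) p (Ideal.Quotient.mk _ x)
  obtain ⟨y, rfl⟩ := Ideal.Quotient.mk_surjective ybar
  refine ⟨y, Ideal.mem_span_singleton.1 (Ideal.Quotient.eq.1 ?_)⟩
  rw [← hy, frobenius_def, map_pow]

/-- In an unramified extension, distinct Galois automorphisms differ by a unit at some integer,
i.e. the inertia group is trivial. -/
theorem exists_isUnit_galoisRestrict_sub
    (p : ℕ) [Fact p.Prime]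
    (F : Type) [Field F] [Algebra ℚ_[p] F] [FiniteDimensional ℚ_[p] F]
    [Algebra ℤ_[p] F] [IsScalarTower ℤ_[p] ℚ_[p] F]
    (hur : ∀ I : Ideal (integralClosure ℤ_[p] F), I.IsMaximal →
      I = Ideal.span {(p : integralClosure ℤ_[p] F)})
    {σ τ : F ≃ₐ[ℚ_[p]] F} (hστ : σ ≠ τ) :
    ∃ x, IsUnit (galoisRestrictToIntegralClosure p F σ x -
      galoisRestrictToIntegralClosure p F τ x) := by
  have := IsIntegralClosure.finite ℤ_[p] ℚ_[p] F (integralClosure ℤ_[p] F)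
  have : IsNoetherianRing (integralClosure ℤ_[p] F) := IsNoetherianRing.of_finite ℤ_[p] _
  have := IsIntegralClosure.isFractionRing_of_finite_extension ℤ_[p] ℚ_[p] F
    (integralClosure ℤ_[p] F)
  have hmax : (Ideal.span {(p : integralClosure ℤ_[p] F)}).IsMaximal := by
    obtain ⟨I, hI⟩ := Ideal.exists_maximal (integralClosure ℤ_[p] F)
    exact hur I hI ▸ hI
  by_contra! hnon
  have hdvd : ∀ x, (p : integralClosure ℤ_[p] F) ∣
      galoisRestrictToIntegralClosure p F (τ⁻¹ * σ) x - x := by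
    intro x
    obtain ⟨I, hI, hxI⟩ := exists_max_ideal_of_mem_nonunits (hnon x)
    rw [hur I hI, Ideal.mem_span_singleton] at hxI
    have h := map_dvd (galoisRestrictToIntegralClosure p F τ⁻¹) hxI
    have hcomp : galoisRestrictToIntegralClosure p F τ⁻¹
        (galoisRestrictToIntegralClosure p F σ x - galoisRestrictToIntegralClosure p F τ x) =
        galoisRestrictToIntegralClosure p F (τ⁻¹ * σ) x - x := by
      rw [map_sub]
      congr 1
      exact Subtype.ext (τ.symm_apply_apply (x : F))
    rwa [map_natCast, hcomp] at h
  have hfix : ∀ x, galoisRestrictToIntegralClosure p F (τ⁻¹ * σ) x = x := by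
    intro x
    rw [← sub_eq_zero, ← Ideal.mem_bot,
      ← Ideal.iInf_pow_eq_bot_of_isDomain _ hmax.ne_top, Ideal.mem_iInf]
    intro k
    rw [Ideal.span_singleton_pow, Ideal.mem_span_singleton]
    exact natCast_pow_dvd_map_sub_self Fact.out (exists_natCast_dvd_sub_pow p hmax)
      (galoisRestrictToIntegralClosure p F (τ⁻¹ * σ) : _ →+* _) hdvd k x
  refine hστ (inv_mul_eq_one.1 ?_).symm
  ext z
  obtain ⟨a, b, -, rfl⟩ := IsFractionRing.div_surjective (integralClosure ℤ_[p] F) z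
  have hval : ∀ x : integralClosure ℤ_[p] F, (τ⁻¹ * σ) (algebraMap _ F x) = algebraMap _ F x :=
    fun x => congrArg Subtype.val (hfix x)
  rw [map_div₀, hval, hval, AlgEquiv.one_apply]

/-- A finite family of endomorphisms whose pairwise differences take unit values gives a
surjection `B ⊗ R → ∏ R`. -/
theorem surjective_of_isUnit_map_sub {A B R G : Type*} [CommRing A] [CommRing B] [CommRing R]
    [Algebra A B] [Algebra A R] [Algebra B R] [Finite G]
    (s : G → B →ₐ[A] B) (Φ : B ⊗[A] R →+* (G → R))
    (hΦ : ∀ x r σ, Φ (x ⊗ₜ r) σ = algebraMap B R (s σ x) * r)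
    (hs : ∀ σ τ, σ ≠ τ → ∃ x, IsUnit (s σ x - s τ x)) : Function.Surjective Φ := by
  classical
  cases nonempty_fintype G
  have hsep : ∀ σ τ, ∃ f, σ ≠ τ → Φ f σ = 1 ∧ Φ f τ = 0 := by
    intro σ τ
    by_cases hστ : σ = τ
    · exact ⟨0, fun h => (h hστ).elim⟩
    obtain ⟨x, hx⟩ := hs σ τ hστ
    obtain ⟨v, hv⟩ := hx.exists_right_inv
    refine ⟨x ⊗ₜ algebraMap B R v - 1 ⊗ₜ algebraMap B R (s τ x * v), fun _ => ⟨?_, ?_⟩⟩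
    · simp only [map_sub, Pi.sub_apply, hΦ, map_one, one_mul]
      rw [← map_mul, ← map_sub, ← sub_mul, hv, map_one]
    · simp only [map_sub, Pi.sub_apply, hΦ, map_one, one_mul, map_mul, sub_self]
  choose f hf using hsep
  intro g
  refine ⟨∑ σ, (∏ τ ∈ Finset.univ.erase σ, f σ τ) * 1 ⊗ₜ g σ, ?_⟩
  ext τ
  simp only [map_sum, map_mul, map_prod, Finset.sum_apply, Pi.mul_apply, Finset.prod_apply, hΦ,
    map_one, one_mul]
  rw [Finset.sum_eq_single τ]
  · rw [Finset.prod_eq_one, one_mul]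
    exact fun ρ hρ => (hf τ ρ (Finset.ne_of_mem_erase hρ).symm).1
  · intro σ _ hστ
    rw [Finset.prod_eq_zero (f := fun ρ => Φ (f σ ρ) τ)
      (Finset.mem_erase.2 ⟨hστ.symm, Finset.mem_univ τ⟩) (hf σ τ hστ).2, zero_mul]
  · simp

/-- If moreover `B` is free over `A` of rank the size of the family, then `B ⊗ R → ∏ R` is
bijective. -/
theorem bijective_of_isUnit_map_sub {A B R G : Type*} [CommRing A] [Nontrivial A] [CommRing B]
    [CommRing R] [Algebra A B] [Algebra A R] [Algebra B R] [IsScalarTower A B R] [Finite G]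
    [Module.Free A B] [Module.Finite A B]
    (s : G → B →ₐ[A] B) (Φ : B ⊗[A] R →+* (G → R))
    (hΦ : ∀ x r σ, Φ (x ⊗ₜ r) σ = algebraMap B R (s σ x) * r)
    (hcard : Module.finrank A B = Nat.card G)
    (hs : ∀ σ τ, σ ≠ τ → ∃ x, IsUnit (s σ x - s τ x)) : Function.Bijective Φ := by
  have hsurj := surjective_of_isUnit_map_sub s Φ hΦ hs
  refine ⟨?_, hsurj⟩
  let b := Module.finBasisOfFinrankEq A B hcard
  let T : (Fin (Nat.card G) → R) →+ B ⊗[A] R :=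
    { toFun := fun c => ∑ i, b i ⊗ₜ c i
      map_zero' := by simp
      map_add' := by simp [TensorProduct.tmul_add, Finset.sum_add_distrib] }
  have hT : Function.Surjective T := by
    intro z
    induction z with
    | zero => exact ⟨0, map_zero T⟩
    | add y z hy hz =>
      obtain ⟨c, rfl⟩ := hy
      obtain ⟨d, rfl⟩ := hz
      exact ⟨c + d, map_add T c d⟩
    | tmul x r =>
      refine ⟨fun i => b.repr x i • r, ?_⟩
      conv_rhs => rw [← b.sum_repr x, TensorProduct.sum_tmul]
      simp [T, TensorProduct.smul_tmul]
  let L : (Fin (Nat.card G) → R) →ₗ[R] (G → R) :=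
    { toFun := fun c => Φ (T c)
      map_add' := by simp
      map_smul' := by
        intro r c
        ext σ
        simp [T, hΦ, Finset.mul_sum, mul_left_comm] }
  have hL : Function.Injective L :=
    OrzechProperty.injective_of_surjective_of_injective
      (LinearEquiv.funCongrLeft R R (Finite.equivFin G)).toLinearMap L
      (LinearEquiv.injective _) (hsurj.comp hT)
  exact Function.Injective.of_comp_right hL hT

/-- Let `F` be a finite Galois extension of `ℚ_p` with
Galois group `G = Gal(F/ℚ_p)` and let `O_F` be the integral closure of
`ℤ_p` in `F`.  Assume `F/ℚ_p` is unramified, i.e. `p` generates the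
maximal ideal of `O_F`.  Then for every commutative `O_F`-algebra `R`, the
ring homomorphism `O_F ⊗_{ℤ_p} R → ∏_{σ ∈ G} R` determined by
`x ⊗ r ↦ (σ(x) · r)_σ` is an isomorphism of rings. -/
theorem integralClosureTensor_iso_pi
    (p : ℕ) [Fact p.Prime]
    (F : Type) [Field F] [Algebra ℚ_[p] F] [FiniteDimensional ℚ_[p] F]
    [IsGalois ℚ_[p] F] [Algebra ℤ_[p] F] [IsScalarTower ℤ_[p] ℚ_[p] F]
    (hur : ∀ I : Ideal (integralClosure ℤ_[p] F), I.IsMaximal →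
      I = Ideal.span {(p : integralClosure ℤ_[p] F)})
    (R : Type) [CommRing R] [Algebra (integralClosure ℤ_[p] F) R]
    [Algebra ℤ_[p] R] [IsScalarTower ℤ_[p] (integralClosure ℤ_[p] F) R] :
    (∀ (x : integralClosure ℤ_[p] F) (r : R),
        integralClosureTensorToPi p F R (x ⊗ₜ[ℤ_[p]] r) =
          fun σ => algebraMap (integralClosure ℤ_[p] F) R
            (galoisRestrictToIntegralClosure p F σ x) * r) ∧
    Function.Bijective (integralClosureTensorToPi p F R) := by
  have htmul : ∀ (x : integralClosure ℤ_[p] F) (r : R),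
      integralClosureTensorToPi p F R (x ⊗ₜ[ℤ_[p]] r) =
        fun σ => algebraMap (integralClosure ℤ_[p] F) R
          (galoisRestrictToIntegralClosure p F σ x) * r := by
    intro x r
    ext σ
    exact Algebra.TensorProduct.lift_tmul _ _ (fun _ _ => Commute.all _ _) x r
  refine ⟨htmul, ?_⟩
  have := IsIntegralClosure.finite ℤ_[p] ℚ_[p] F (integralClosure ℤ_[p] F)
  have : Module.IsTorsionFree ℤ_[p] F := .trans_faithfulSMul ℤ_[p] ℚ_[p] F
  have := IsIntegralClosure.module_free ℤ_[p] ℚ_[p] F (integralClosure ℤ_[p] F)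
  refine bijective_of_isUnit_map_sub (galoisRestrictToIntegralClosure p F) _
    (fun x r σ => congrFun (htmul x r) σ) ?_
    (fun σ τ hστ => exists_isUnit_galoisRestrict_sub p F hur hστ)
  rw [IsIntegralClosure.rank ℤ_[p] ℚ_[p] F, IsGalois.card_aut_eq_finrank]
end
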